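/- Let ρ* be a C¹ probability density on ℝᵈ vanishing outside a compact set Ω with ρ*|_{∂Ω} = 0, and suppose ρ* satisfies both ∇·(b₁ ρ*) = 0 and ∇·(b₂ ρ*) − (1/2)∇²:(σσᵀ ρ*) = 0 for C¹ vector fields b₁, b₂ and a matrix field σ with σσᵀ positive definite, and ∇·b₁ is not identically zero on the support of ρ*. Then ρ* ≡ 0, a contradiction with ρ* being a probability density; hence no such ρ* exists. -/

import Mathlib

open MeasureTheory

/-- Partial derivative in the `i`-th coordinate direction of `f : (Fin d → ℝ) → ℝ`. -/
noncomputable def pd {d : ℕ} (i : Fin d) (f : (Fin d → ℝ) → ℝ) (x : Fin d → ℝ) : ℝ :=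
  fderiv ℝ f x (Pi.single i 1)

lemma aux_contDiff_pd {d : ℕ} (i : Fin d) {f : (Fin d → ℝ) → ℝ} (hf : ContDiff ℝ 2 f) :
    ContDiff ℝ 1 (fun y => pd i f y) := by
  unfold pd
  exact (hf.fderiv_right (m := 1) (by norm_num)).clm_apply contDiff_const

lemma aux_cs_pd {d : ℕ} (i : Fin d) {f : (Fin d → ℝ) → ℝ} (hf : HasCompactSupport f) :
    HasCompactSupport (fun y => pd i f y) := by
  unfold pd
  exact hf.fderiv_apply (𝕜 := ℝ) _

lemma aux_cont_pd {d : ℕ} (i : Fin d) {f : (Fin d → ℝ) → ℝ} (hf : ContDiff ℝ 1 f) :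
    Continuous (fun y => pd i f y) := by
  unfold pd
  exact (hf.continuous_fderiv (by norm_num)).clm_apply continuous_const

lemma aux_pd_exp {d : ℕ} (k i : Fin d) (l : ℝ) (x : Fin d → ℝ) :
    pd i (fun y => Real.exp (l * y k)) x = (if i = k then l else 0) * Real.exp (l * x k) := by
  unfold pd
  have h1 : HasFDerivAt (fun y : Fin d → ℝ => y k)
      (ContinuousLinearMap.proj (R := ℝ) (φ := fun _ : Fin d => ℝ) k) x :=
    (ContinuousLinearMap.proj (R := ℝ) (φ := fun _ : Fin d => ℝ) k).hasFDerivAt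
  have h2 := (h1.const_mul l).exp
  rw [h2.fderiv]
  by_cases h : i = k
  · subst h; simp; ring
  · simp [h, Ne.symm h]

lemma aux_ibp {d : ℕ} (k i : Fin d) (l : ℝ) {f : (Fin d → ℝ) → ℝ}
    (hf : ContDiff ℝ 1 f) (hc : HasCompactSupport f) :
    ∫ x, Real.exp (l * x k) * pd i f x
      = -((if i = k then l else 0) * ∫ x, Real.exp (l * x k) * f x) := by
  have hE : ContDiff ℝ 1 (fun y : Fin d → ℝ => Real.exp (l * y k)) := by fun_prop
  have h := integral_mul_fderiv_eq_neg_fderiv_mul_of_integrable (𝕜 := ℝ)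
    (μ := (volume : Measure (Fin d → ℝ)))
    (f := fun y : Fin d → ℝ => Real.exp (l * y k)) (g := f) (v := Pi.single i 1)
    (((aux_cont_pd i hE).mul hf.continuous).integrable_of_hasCompactSupport hc.mul_left)
    ((hE.continuous.mul (aux_cont_pd i hf)).integrable_of_hasCompactSupport
      (aux_cs_pd i hc).mul_left)
    ((hE.continuous.mul hf.continuous).integrable_of_hasCompactSupport hc.mul_left)
    (fun x _ => hE.differentiable (by norm_num) x)
    (fun x _ => hf.differentiable (by norm_num) x)
  change ∫ x, Real.exp (l * x k) * pd i f x
    = -∫ x, pd i (fun y => Real.exp (l * y k)) x * f x at h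
  rw [h, ← integral_const_mul]
  simp only [aux_pd_exp, mul_assoc]

theorem no_deterministic_invariant_density_for_stochastic_closure
    (d : ℕ)
    (ρ : (Fin d → ℝ) → ℝ) (b₁ b₂ : Fin d → (Fin d → ℝ) → ℝ)
    (a : Fin d → Fin d → (Fin d → ℝ) → ℝ)  -- `a = σσᵀ`
    (Ω : Set (Fin d → ℝ)) (hΩcompact : IsCompact Ω)
    (hρsmooth : ContDiff ℝ 2 ρ)
    (hb₁smooth : ∀ i, ContDiff ℝ 1 (b₁ i))
    (hb₂smooth : ∀ i, ContDiff ℝ 1 (b₂ i))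
    (hasmooth : ∀ i j, ContDiff ℝ 2 (a i j))
    (hρnonneg : ∀ x, 0 ≤ ρ x)
    (hρprob : ∫ x, ρ x = 1)
    (hρsupp : ∀ x ∉ Ω, ρ x = 0)
    (hρbdry : ∀ x ∈ frontier Ω, ρ x = 0)
    (hposdef : ∀ x : Fin d → ℝ, ∀ ξ : Fin d → ℝ, ξ ≠ 0 →
      0 < ∑ i, ∑ j, a i j x * ξ i * ξ j)
    (hLiouville : ∀ x, ∑ i, pd i (fun y => b₁ i y * ρ y) x = 0)
    (hFokkerPlanck : ∀ x,
      ∑ i, pd i (fun y => b₂ i y * ρ y) x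
        - (1 / 2 : ℝ) * ∑ i, ∑ j, pd i (fun y => pd j (fun z => a i j z * ρ z) y) x = 0)
    (hdivb₁ : ∃ x ∈ Function.support ρ, ∑ i, pd i (b₁ i) x ≠ 0) :
    False := by
  obtain ⟨x₀, hx₀, hdiv⟩ := hdivb₁
  have hd : 0 < d := by
    rcases Nat.eq_zero_or_pos d with h | h
    · subst h; simp at hdiv
    · exact h
  let k : Fin d := ⟨0, hd⟩
  have hρc : HasCompactSupport ρ := HasCompactSupport.intro hΩcompact hρsupp
  have hapos : ∀ x, 0 < a k k x := by
    intro x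
    have := hposdef x (Pi.single k 1) (by simp)
    simpa [Pi.single_apply] using this
  have hcont : Continuous (fun x => -2 * b₂ k x / a k k x) :=
    (continuous_const.mul (hb₂smooth k).continuous).div (hasmooth k k).continuous
      (fun x => (hapos x).ne')
  obtain ⟨C, hC⟩ := (hΩcompact.image hcont).bddAbove
  obtain ⟨l, hl0, hlC⟩ : ∃ l : ℝ, 0 < l ∧ C < l :=
    ⟨max C 0 + 1, by positivity, by linarith [le_max_left C 0]⟩
  have hlpos : ∀ x ∈ Ω, 0 < b₂ k x + 1 / 2 * l * a k k x := by
    intro x hx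
    have h1 : -2 * b₂ k x / a k k x < l := (hC ⟨x, hx, rfl⟩).trans_lt hlC
    rw [div_lt_iff₀ (hapos x)] at h1
    linarith
  have hρ1 : ContDiff ℝ 1 ρ := hρsmooth.of_le (by norm_num)
  have hB1 : ∀ i, ContDiff ℝ 1 (fun y => b₂ i y * ρ y) := fun i => (hb₂smooth i).mul hρ1
  have hBc : ∀ i, HasCompactSupport (fun y => b₂ i y * ρ y) := fun i => hρc.mul_left
  have hA2 : ∀ i j, ContDiff ℝ 2 (fun y => a i j y * ρ y) :=
    fun i j => (hasmooth i j).mul hρsmooth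
  have hAc : ∀ i j, HasCompactSupport (fun y => a i j y * ρ y) := fun i j => hρc.mul_left
  have hE : Continuous (fun y : Fin d → ℝ => Real.exp (l * y k)) := by fun_prop
  have hIB : ∀ i, Integrable
      (fun x => Real.exp (l * x k) * pd i (fun y => b₂ i y * ρ y) x) := fun i =>
    (hE.mul (aux_cont_pd i (hB1 i))).integrable_of_hasCompactSupport
      (aux_cs_pd i (hBc i)).mul_left
  have hIA : ∀ i j, Integrable (fun x => Real.exp (l * x k) *
      pd i (fun y => pd j (fun z => a i j z * ρ z) y) x) := fun i j =>
    (hE.mul (aux_cont_pd i (aux_contDiff_pd j (hA2 i j)))).integrable_of_hasCompactSupport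
      (aux_cs_pd i (aux_cs_pd j (hAc i j))).mul_left
  have hSB : ∫ x, ∑ i, Real.exp (l * x k) * pd i (fun y => b₂ i y * ρ y) x
      = -(l * ∫ x, Real.exp (l * x k) * (b₂ k x * ρ x)) := by
    rw [integral_finsetSum _ (fun i _ => hIB i)]
    simp_rw [fun i => aux_ibp k i l (hB1 i) (hBc i)]
    simp
  have hSA : ∫ x, ∑ i, ∑ j, Real.exp (l * x k) *
        pd i (fun y => pd j (fun z => a i j z * ρ z) y) x
      = l * (l * ∫ x, Real.exp (l * x k) * (a k k x * ρ x)) := by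
    rw [integral_finsetSum _ (fun i _ => integrable_finsetSum _ (fun j _ => hIA i j))]
    simp_rw [fun i => integral_finsetSum Finset.univ (fun j _ => hIA i j)]
    simp_rw [fun i j => aux_ibp k i l (aux_contDiff_pd j (hA2 i j)) (aux_cs_pd j (hAc i j)),
      fun i j => aux_ibp k j l ((hA2 i j).of_le (by norm_num : (1 : WithTop ℕ∞) ≤ 2)) (hAc i j)]
    simp
  have hzero : ∫ x, ((∑ i, Real.exp (l * x k) * pd i (fun y => b₂ i y * ρ y) x)
      - (1 / 2 : ℝ) * ∑ i, ∑ j, Real.exp (l * x k) *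
        pd i (fun y => pd j (fun z => a i j z * ρ z) y) x) = 0 := by
    rw [← integral_zero (Fin d → ℝ) ℝ]
    congr 1
    ext x
    simp_rw [← Finset.mul_sum]
    linear_combination Real.exp (l * x k) * hFokkerPlanck x
  rw [integral_sub (integrable_finsetSum _ (fun i _ => hIB i))
    ((integrable_finsetSum _ (fun i _ => integrable_finsetSum _ (fun j _ => hIA i j))).const_mul _),
    integral_const_mul, hSB, hSA] at hzero
  have hI1 : Integrable (fun x => Real.exp (l * x k) * (b₂ k x * ρ x)) :=
    (hE.mul (hB1 k).continuous).integrable_of_hasCompactSupport (hBc k).mul_left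
  have hI2 : Integrable (fun x => Real.exp (l * x k) * (a k k x * ρ x)) :=
    (hE.mul (hA2 k k).continuous).integrable_of_hasCompactSupport (hAc k k).mul_left
  have hG : ∫ x, (Real.exp (l * x k) * (b₂ k x + 1 / 2 * l * a k k x)) * ρ x = 0 := by
    have : ∀ x, (Real.exp (l * x k) * (b₂ k x + 1 / 2 * l * a k k x)) * ρ x
        = Real.exp (l * x k) * (b₂ k x * ρ x)
          + (1 / 2 * l) * (Real.exp (l * x k) * (a k k x * ρ x)) := fun x => by ring
    rw [integral_congr_ae (Filter.Eventually.of_forall this)]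
    rw [integral_add hI1 (hI2.const_mul _), integral_const_mul]
    have : l ≠ 0 := hl0.ne'
    apply mul_left_cancel₀ this
    linear_combination -hzero
  have hx₀Ω : x₀ ∈ Ω := by
    by_contra h
    exact hx₀ (hρsupp x₀ h)
  have hpos : 0 < ∫ x, (Real.exp (l * x k) * (b₂ k x + 1 / 2 * l * a k k x)) * ρ x := by
    refine Continuous.integral_pos_of_hasCompactSupport_nonneg_nonzero (x := x₀)
      ?_ hρc.mul_left ?_ ?_
    · exact (hE.mul ((hb₂smooth k).continuous.add
        (continuous_const.mul (hasmooth k k).continuous))).mul hρsmooth.continuous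
    · intro x
      by_cases hx : x ∈ Ω
      · exact mul_nonneg (mul_nonneg (Real.exp_pos _).le (hlpos x hx).le) (hρnonneg x)
      · simp [hρsupp x hx]
    · exact mul_ne_zero (mul_pos (Real.exp_pos _) (hlpos x₀ hx₀Ω)).ne' hx₀
  exact hpos.ne' hG
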